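/- Let a > 0 and ω ∈ ℝ. Then the function w ↦ e^{−w²/2} e^{−iωw}/(w − ia) is integrable on ℝ and ∫_ℝ e^{−w²/2} e^{−iωw} (w − ia)^{−1} dw = 2π i e^{−ω²/2} e^{(ω+a)²/2} Φ^c(ω+a) = i √(2π) e^{−ω²/2} φ(ω+a). -/

import Mathlib

open MeasureTheory

/-- The Gaussian tail function `Φ^c(w) = (2π)^{-1/2} ∫_w^∞ e^{−s²/2} ds`. -/
noncomputable def Phic (w : ℝ) : ℝ :=
  (1 / Real.sqrt (2 * Real.pi)) * ∫ s in Set.Ioi w, Real.exp (-s ^ 2 / 2)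

/-- `φ(w) = √(2π) e^{w²/2} Φ^c(w)`. -/
noncomputable def phifun (w : ℝ) : ℝ :=
  Real.sqrt (2 * Real.pi) * Real.exp (w ^ 2 / 2) * Phic w

theorem stmt11_fub (a : ℝ) (ha : 0 < a) (ω : ℝ) :
    Integrable (Function.uncurry (fun (w t : ℝ) =>
      Complex.I * ((Real.exp (-w ^ 2 / 2) * Complex.exp (-Complex.I * ω * w)) *
        Complex.exp (-(a + Complex.I * w) * t))))
      (volume.prod (volume.restrict (Set.Ioi (0:ℝ)))) := by
  have h1 : Integrable (fun w : ℝ => Real.exp (-w ^ 2 / 2)) := by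
    have := integrable_exp_neg_mul_sq (b := 1/2) (by norm_num)
    refine this.congr (Filter.Eventually.of_forall fun w => ?_)
    simp only
    congr 1
    ring
  have h2 : Integrable (fun t : ℝ => Real.exp (-a * t)) (volume.restrict (Set.Ioi (0:ℝ))) :=
    exp_neg_integrableOn_Ioi 0 ha
  refine (h1.mul_prod h2).mono' ?_ (Filter.Eventually.of_forall fun p => ?_)
  · apply Continuous.aestronglyMeasurable
    unfold Function.uncurry
    fun_prop
  · obtain ⟨w, t⟩ := p
    simp only [Function.uncurry, norm_mul, Complex.norm_I, Complex.norm_exp, Complex.norm_real]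
    simp

theorem stmt11_inner (a : ℝ) (ha : 0 < a) (ω w : ℝ) :
    ∫ t in Set.Ioi (0:ℝ), Complex.I * ((Real.exp (-w ^ 2 / 2) * Complex.exp (-Complex.I * ω * w)) *
        Complex.exp (-(a + Complex.I * w) * t)) =
      Real.exp (-w ^ 2 / 2) * Complex.exp (-Complex.I * ω * w) / ((w : ℂ) - Complex.I * a) := by
  rw [integral_const_mul, integral_const_mul, integral_exp_mul_complex_Ioi (by simpa using ha)]
  have h0 : (a + Complex.I * w : ℂ) ≠ 0 := by
    intro h
    have := congrArg Complex.re h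
    simp at this
    exact ha.ne' this
  have e : (w : ℂ) - Complex.I * a = -Complex.I * (a + Complex.I * w) := by
    linear_combination (w : ℂ) * Complex.I_sq
  rw [e]
  have := Complex.I_ne_zero
  simp only [Complex.ofReal_zero, mul_zero, Complex.exp_zero]
  field_simp
  linear_combination (1 : ℂ) * Complex.I_sq

theorem stmt11_outer (a ω t : ℝ) :
    ∫ w : ℝ, Complex.I * ((Real.exp (-w ^ 2 / 2) * Complex.exp (-Complex.I * ω * w)) *
        Complex.exp (-(a + Complex.I * w) * t)) =
      Complex.I * (Real.sqrt (2 * Real.pi) : ℝ) *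
        ((Real.exp (-ω ^ 2 / 2) * Real.exp ((ω + a) ^ 2 / 2) *
          Real.exp (-(t + (ω + a)) ^ 2 / 2) : ℝ) : ℂ) := by
  rw [integral_const_mul]
  have e : ∀ w : ℝ, (Real.exp (-w ^ 2 / 2) * Complex.exp (-Complex.I * ω * w)) *
        Complex.exp (-(a + Complex.I * w) * t) =
      Complex.exp ((-1/2 : ℂ) * w ^ 2 + (-Complex.I * (ω + t)) * w + (-a * t)) := by
    intro w
    rw [Complex.ofReal_exp, ← Complex.exp_add, ← Complex.exp_add]
    congr 1
    push_cast
    ring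
  simp_rw [e]
  rw [integral_cexp_quadratic (by norm_num)]
  have r : ((Real.pi : ℂ) / -(-1/2 : ℂ)) ^ (1/2 : ℂ) = (Real.sqrt (2 * Real.pi) : ℝ) := by
    rw [Real.sqrt_eq_rpow, Complex.ofReal_cpow (by positivity)]
    congr 1
    · push_cast; ring
    · push_cast; ring
  rw [r, mul_assoc]
  congr 2
  push_cast
  rw [← Complex.exp_add, ← Complex.exp_add]
  congr 1
  linear_combination ((ω + t : ℂ)^2 / 2) * Complex.I_sq

theorem stmt11_tail (c : ℝ) :
    ∫ t in Set.Ioi (0:ℝ), Real.exp (-(t + c) ^ 2 / 2) = Real.sqrt (2 * Real.pi) * Phic c := by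
  have h := (measurePreserving_add_right (volume : Measure ℝ) c).setIntegral_preimage_emb
    (measurableEmbedding_addRight c) (fun s : ℝ => Real.exp (-s ^ 2 / 2)) (Set.Ioi c)
  rw [Set.preimage_add_const_Ioi, sub_self] at h
  rw [h, Phic]
  have : Real.sqrt (2 * Real.pi) ≠ 0 := by positivity
  field_simp

/-- The Fourier transform of a Gaussian times a simple pole (proof of Lemma 3.2
of the paper). -/
theorem stmt11 (a : ℝ) (ha : 0 < a) (ω : ℝ) :
    Integrable (fun w : ℝ =>
      Real.exp (-w ^ 2 / 2) * Complex.exp (-Complex.I * ω * w) / ((w : ℂ) - Complex.I * a)) ∧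
    (∫ w : ℝ, Real.exp (-w ^ 2 / 2) * Complex.exp (-Complex.I * ω * w) /
        ((w : ℂ) - Complex.I * a)) =
      (2 * Real.pi : ℝ) * Complex.I *
        ((Real.exp (-ω ^ 2 / 2) * Real.exp ((ω + a) ^ 2 / 2) * Phic (ω + a) : ℝ) : ℂ) ∧
    (∫ w : ℝ, Real.exp (-w ^ 2 / 2) * Complex.exp (-Complex.I * ω * w) /
        ((w : ℂ) - Complex.I * a)) =
      Complex.I * (Real.sqrt (2 * Real.pi) : ℝ) *
        ((Real.exp (-ω ^ 2 / 2) * phifun (ω + a) : ℝ) : ℂ) := by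
  have hf := stmt11_fub a ha ω
  have hs : ((Real.sqrt (2 * Real.pi) : ℝ) : ℂ) * (Real.sqrt (2 * Real.pi) : ℝ) =
      (2 * Real.pi : ℝ) := by
    rw [← Complex.ofReal_mul, Real.mul_self_sqrt (by positivity)]
  have key : (∫ w : ℝ, Real.exp (-w ^ 2 / 2) * Complex.exp (-Complex.I * ω * w) /
        ((w : ℂ) - Complex.I * a)) =
      (2 * Real.pi : ℝ) * Complex.I *
        ((Real.exp (-ω ^ 2 / 2) * Real.exp ((ω + a) ^ 2 / 2) * Phic (ω + a) : ℝ) : ℂ) := by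
    have h := integral_integral_swap hf
    simp_rw [stmt11_inner a ha ω, stmt11_outer a ω] at h
    rw [h, integral_const_mul, integral_complex_ofReal, integral_const_mul, stmt11_tail, ← hs]
    push_cast
    ring
  refine ⟨?_, key, ?_⟩
  · have h := hf.integral_prod_left
    simp only [Function.uncurry] at h
    simp_rw [stmt11_inner a ha ω] at h
    exact h
  · rw [key, ← hs, phifun]
    push_cast
    ring
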